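/- arXiv:2503.09741 — 3 statements merged into one kernel-verified Lean document; each statement's English description precedes it below -/
import Mathlib

section
/- Suppose χ₁ and χ₂ are both odd (χ₁(−1) = χ₂(−1) = −1). Let γ = (a, b; r·q₁q₂, d) ∈ Γ₀(q₁q₂) with r ≥ 1, and let γ' = (d, −r; −b·q₁q₂, a). Then S_{χ₁,χ₂}(γ) = −S_{χ₂,χ₁}(γ') + (1 − ψ(γ)) · (τ(conj(χ₁)) · τ(conj(χ₂)) / (πi)²) · L(1, χ₁) · L(1, χ₂). -/
open Complex Finset
open scoped Classical

/-- The sawtooth function `B₁(x)`: `0` if `x ∈ ℤ`, and `x - ⌊x⌋ - 1/2` otherwise. -/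
noncomputable def sawtooth (x : ℝ) : ℝ :=
  if ∃ n : ℤ, (n : ℝ) = x then 0 else Int.fract x - 1 / 2

/-- The newform Dedekind sum `S_{χ₁,χ₂}(a, c)` associated to Dirichlet characters
`χ₁ mod q₁` and `χ₂ mod q₂`. -/
noncomputable def newformDedekindSum {q₁ q₂ : ℕ} (χ₁ : DirichletCharacter ℂ q₁)
    (χ₂ : DirichletCharacter ℂ q₂) (a c : ℤ) : ℂ :=
  ∑ j ∈ Finset.range c.toNat, ∑ n ∈ Finset.range q₁,
    (starRingEnd ℂ) (χ₂ (j : ZMod q₂)) * (starRingEnd ℂ) (χ₁ (n : ZMod q₁)) *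
      (sawtooth ((j : ℝ) / (c : ℝ)) : ℂ) *
      (sawtooth ((n : ℝ) / (q₁ : ℝ) + (a : ℝ) * (j : ℝ) / (c : ℝ)) : ℂ)

/-- The newform Dedekind sum of a matrix `γ = (a, b; c, d) ∈ SL₂(ℤ)`:
it is `S_{χ₁,χ₂}(a, c)` if `c ≥ 1`, `S_{χ₁,χ₂}(-γ)` if `c ≤ -1`, and `0` if `c = 0`. -/
noncomputable def newformDedekindSumSL {q₁ q₂ : ℕ} (χ₁ : DirichletCharacter ℂ q₁)
    (χ₂ : DirichletCharacter ℂ q₂) (γ : Matrix.SpecialLinearGroup (Fin 2) ℤ) : ℂ :=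
  if γ.1 1 0 = 0 then 0
  else if 1 ≤ γ.1 1 0 then newformDedekindSum χ₁ χ₂ (γ.1 0 0) (γ.1 1 0)
  else newformDedekindSum χ₁ χ₂ (-(γ.1 0 0)) (-(γ.1 1 0))

/-- Membership in `Γ₀(N)`: the lower-left entry is divisible by `N`. -/
def InGamma0 (N : ℕ) (γ : Matrix.SpecialLinearGroup (Fin 2) ℤ) : Prop :=
  (N : ℤ) ∣ γ.1 1 0

/-- Membership in `Γ₁(N)`: lower-left entry divisible by `N` and both diagonal
entries congruent to `1` mod `N`. -/
def InGamma1 (N : ℕ) (γ : Matrix.SpecialLinearGroup (Fin 2) ℤ) : Prop :=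
  InGamma0 N γ ∧ (N : ℤ) ∣ (γ.1 0 0 - 1) ∧ (N : ℤ) ∣ (γ.1 1 1 - 1)

/-- `x` lies in the ring of integers `ℤ[χ₁,χ₂]` of the field `F_{χ₁,χ₂} ⊆ ℂ` generated
by the values of `χ₁` and `χ₂`: `x` lies in the subfield of `ℂ` generated by the values
of the characters and is integral over `ℤ`. -/
def InRingOfIntegers {q₁ q₂ : ℕ} (χ₁ : DirichletCharacter ℂ q₁)
    (χ₂ : DirichletCharacter ℂ q₂) (x : ℂ) : Prop :=
  x ∈ Subfield.closure (Set.range (χ₁ : ZMod q₁ → ℂ) ∪ Set.range (χ₂ : ZMod q₂ → ℂ)) ∧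
    IsIntegral ℤ x

/-- The Gauss sum `τ(χ) = ∑_{n=0}^{q-1} χ(n) e^{2πin/q}` of a function `χ` on `ZMod q`. -/
noncomputable def gaussSum' (q : ℕ) (χ : ZMod q → ℂ) : ℂ :=
  ∑ n ∈ Finset.range q, χ (n : ZMod q) * Complex.exp (2 * Real.pi * Complex.I * n / q)
lemma abs_rpow_neg_sub_rpow_neg_le {w u v s : ℝ} (hw : 0 < w) (hu : w ≤ u) (hv : w ≤ v)
    (huv : |u - v| ≤ 1) (hs₁ : 1 ≤ s) (hs₂ : s ≤ 2) :
    |u ^ (-s) - v ^ (-s)| ≤ 2 * (w⁻¹ ^ 2 + w⁻¹ ^ 3) := by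
  wlog h : u ≤ v generalizing u v
  · rw [abs_sub_comm]
    exact this hv hu (by rwa [abs_sub_comm]) (le_of_not_ge h)
  have hu0 : 0 < u := hw.trans_le hu
  have hv0 : 0 < v := hw.trans_le hv
  have hpow : u⁻¹ ^ s ≤ w⁻¹ + w⁻¹ ^ 2 := by
    have hle : u⁻¹ ≤ w⁻¹ := inv_anti₀ hw hu
    have h1 : u⁻¹ ^ s ≤ u⁻¹ + u⁻¹ ^ 2 := by
      rcases le_total u⁻¹ 1 with h1 | h1
      · have := Real.rpow_le_rpow_of_exponent_ge (inv_pos.2 hu0) h1 hs₁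
        rw [Real.rpow_one] at this
        nlinarith [sq_nonneg u⁻¹]
      · have := Real.rpow_le_rpow_of_exponent_le h1 hs₂
        rw [Real.rpow_two] at this
        nlinarith [inv_pos.2 hu0]
    have h2 : 0 < u⁻¹ := inv_pos.2 hu0
    nlinarith
  have hfac : u ^ (-s) - v ^ (-s) = u⁻¹ ^ s * (1 - (u / v) ^ s) := by
    rw [Real.rpow_neg hu0.le, Real.rpow_neg hv0.le, Real.inv_rpow hu0.le,
      Real.div_rpow hu0.le hv0.le]
    have : u ^ s ≠ 0 := (Real.rpow_pos_of_pos hu0 s).ne'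
    field_simp
  have hq0 : 0 < u / v := div_pos hu0 hv0
  have hq1 : u / v ≤ 1 := (div_le_one hv0).2 h
  have h3 : (u / v) ^ 2 ≤ (u / v) ^ s := by
    rw [← Real.rpow_two]
    exact Real.rpow_le_rpow_of_exponent_ge hq0 hq1 hs₂
  have h4 : (u / v) ^ s ≤ 1 := Real.rpow_le_one hq0.le hq1 (by linarith)
  have h5 : 1 - u / v ≤ w⁻¹ := by
    have : 1 - u / v = (v - u) * v⁻¹ := by field_simp
    rw [this]
    have h6 : v - u ≤ 1 := by rw [abs_sub_comm] at huv; exact (abs_le.1 huv).2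
    have h7 : v⁻¹ ≤ w⁻¹ := inv_anti₀ hw hv
    have h8 : 0 < v⁻¹ := inv_pos.2 hv0
    nlinarith
  rw [hfac, abs_of_nonneg (mul_nonneg (by positivity) (by linarith))]
  have h6 : 1 - (u / v) ^ s ≤ 2 * w⁻¹ := by nlinarith
  have hw' : 0 < w⁻¹ := inv_pos.2 hw
  calc u⁻¹ ^ s * (1 - (u / v) ^ s) ≤ (w⁻¹ + w⁻¹ ^ 2) * (2 * w⁻¹) :=
        mul_le_mul hpow h6 (by linarith) (by positivity)
    _ = _ := by ring

lemma exists_summable_bound_hurwitzZetaOdd_term {a : ℝ} (ha : a ∈ Set.Ioo (0 : ℝ) 1) :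
    ∃ B : ℕ → ℝ, Summable B ∧ ∀ s : ℝ, 1 ≤ s → s ≤ 2 → ∀ n : ℕ,
      ‖(1 / (n + a : ℂ) ^ (s : ℂ) - 1 / (n + 1 - a : ℂ) ^ (s : ℂ)) / 2‖ ≤ B n := by
  obtain ⟨ha0, ha1⟩ := ha
  set δ := min a (1 - a) with hδ
  have hδ0 : 0 < δ := lt_min ha0 (by linarith)
  have hδa : δ ≤ a := min_le_left _ _
  have hδb : δ ≤ 1 - a := min_le_right _ _
  refine ⟨fun n ↦ δ⁻¹ ^ 2 * (((n + 1 : ℕ) : ℝ) ^ 2)⁻¹ + δ⁻¹ ^ 3 * (((n + 1 : ℕ) : ℝ) ^ 3)⁻¹,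
    ?_, ?_⟩
  · have h2 := (summable_nat_add_iff 1).2 (Real.summable_nat_pow_inv.2 (by norm_num : 1 < 2))
    have h3 := (summable_nat_add_iff 1).2 (Real.summable_nat_pow_inv.2 (by norm_num : 1 < 3))
    exact (h2.mul_left _).add (h3.mul_left _)
  · intro s hs₁ hs₂ n
    have hn : (0 : ℝ) ≤ n := Nat.cast_nonneg n
    have hu : 0 < (n : ℝ) + a := by positivity
    have hv : 0 < (n : ℝ) + 1 - a := by linarith
    have key := abs_rpow_neg_sub_rpow_neg_le (w := δ * (n + 1)) (u := n + a) (v := n + 1 - a)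
      (by positivity) (by nlinarith) (by nlinarith) (by rw [abs_le]; constructor <;> linarith)
      hs₁ hs₂
    have hcast : (1 / (n + a : ℂ) ^ (s : ℂ) - 1 / (n + 1 - a : ℂ) ^ (s : ℂ)) / 2 =
        (((((n : ℝ) + a) ^ (-s) - ((n : ℝ) + 1 - a) ^ (-s)) / 2 : ℝ) : ℂ) := by
      rw [Real.rpow_neg hu.le, Real.rpow_neg hv.le]
      push_cast [Complex.ofReal_cpow hu.le, Complex.ofReal_cpow hv.le]
      simp only [one_div]
    rw [hcast, Complex.norm_real, Real.norm_eq_abs, abs_div, abs_two]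
    have e : 2 * ((δ * ((n : ℝ) + 1))⁻¹ ^ 2 + (δ * ((n : ℝ) + 1))⁻¹ ^ 3) =
      2 * (δ⁻¹ ^ 2 * (((n + 1 : ℕ) : ℝ) ^ 2)⁻¹ + δ⁻¹ ^ 3 * (((n + 1 : ℕ) : ℝ) ^ 3)⁻¹) := by
      push_cast
      simp only [mul_inv, mul_pow, inv_pow]
    rw [e] at key
    linarith

lemma hasSum_one_div_sub_one_div_cot {a : ℝ} (ha : a ∈ Set.Ioo (0 : ℝ) 1) :
    HasSum (fun n : ℕ ↦ (1 / (n + a : ℂ) - 1 / (n + 1 - a : ℂ)) / 2)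
      (Real.pi * Complex.cot (Real.pi * a) / 2) := by
  obtain ⟨B, hB, hle⟩ := exists_summable_bound_hurwitzZetaOdd_term ha
  have hsum : Summable (fun n : ℕ ↦ (1 / (n + a : ℂ) - 1 / (n + 1 - a : ℂ)) / 2) :=
    Summable.of_norm_bounded hB fun n ↦ by simpa using hle 1 le_rfl one_le_two n
  obtain ⟨ha0, ha1⟩ := ha
  have haZ : (a : ℂ) ∈ Complex.integerComplement := by
    rintro ⟨m, hm⟩
    have hm' : (m : ℝ) = a := by exact_mod_cast hm
    rw [← hm'] at ha0 ha1
    norm_cast at ha0 ha1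
    lia
  rw [hsum.hasSum_iff_tendsto_nat]
  have hpart : ∀ N : ℕ, ∑ n ∈ range N, (1 / (n + a : ℂ) - 1 / (n + 1 - a : ℂ)) / 2 =
      (1 / (a : ℂ) + ∑ n ∈ range N, cotTerm a n - 1 / (N + a : ℂ)) / 2 := by
    intro N
    induction N with
    | zero => simp
    | succ N ih =>
      rw [sum_range_succ, ih, sum_range_succ, cotTerm]
      have : (1 : ℂ) / (a - (N + 1)) = - (1 / (N + 1 - a)) := by
        rw [← neg_sub, one_div_neg_eq_neg_one_div]
      rw [this]
      push_cast
      ring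
  simp_rw [hpart]
  have hz : Filter.Tendsto (fun N : ℕ ↦ 1 / (N + a : ℂ)) Filter.atTop (nhds 0) := by
    have h := (tendsto_inv_atTop_zero.comp
      (tendsto_natCast_atTop_atTop.atTop_add (tendsto_const_nhds (x := a))))
    have h' := (Complex.continuous_ofReal.tendsto 0).comp h
    refine h'.congr fun N ↦ ?_
    simp
  have := (((tendsto_logDeriv_euler_cot_sub haZ).const_add (1 / (a : ℂ))).sub hz).div_const 2
  convert this using 2
  ring

lemma hurwitzZetaOdd_one {a : ℝ} (ha : a ∈ Set.Ioo (0 : ℝ) 1) :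
    HurwitzZeta.hurwitzZetaOdd a 1 = Real.pi * Complex.cot (Real.pi * a) / 2 := by
  obtain ⟨B, hB, hle⟩ := exists_summable_bound_hurwitzZetaOdd_term ha
  have hcont : Filter.Tendsto (fun s : ℝ ↦ HurwitzZeta.hurwitzZetaOdd a (s : ℂ))
      (nhdsWithin 1 (Set.Ioi 1)) (nhds (HurwitzZeta.hurwitzZetaOdd a 1)) := by
    have : Continuous fun s : ℝ ↦ HurwitzZeta.hurwitzZetaOdd a (s : ℂ) :=
      (HurwitzZeta.differentiable_hurwitzZetaOdd a).continuous.comp Complex.continuous_ofReal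
    simpa using (this.tendsto 1).mono_left nhdsWithin_le_nhds
  have hmem : ∀ᶠ s : ℝ in nhdsWithin 1 (Set.Ioi 1), 1 < s ∧ s ≤ 2 := by
    filter_upwards [Ioc_mem_nhdsGT one_lt_two] with s hs using hs
  have hdom := tendsto_tsum_of_dominated_convergence (𝓕 := nhdsWithin (1 : ℝ) (Set.Ioi 1))
    (f := fun (s : ℝ) (n : ℕ) ↦ (1 / (n + a : ℂ) ^ (s : ℂ) - 1 / (n + 1 - a : ℂ) ^ (s : ℂ)) / 2)
    (g := fun n : ℕ ↦ (1 / (n + a : ℂ) - 1 / (n + 1 - a : ℂ)) / 2) hB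
    (fun n ↦ by
      have hn : (0 : ℝ) ≤ n := Nat.cast_nonneg n
      have hu : (n + a : ℂ) ≠ 0 := by
        have : (n : ℝ) + a ≠ 0 := by linarith [ha.1]
        exact_mod_cast this
      have hv : (n + 1 - a : ℂ) ≠ 0 := by
        have : (n : ℝ) + 1 - a ≠ 0 := by linarith [ha.2]
        exact_mod_cast this
      have hc : ∀ z : ℂ, z ≠ 0 → Filter.Tendsto (fun s : ℝ ↦ 1 / z ^ (s : ℂ))
          (nhdsWithin 1 (Set.Ioi 1)) (nhds (1 / z)) := by
        intro z hz
        have h1 : Filter.Tendsto (fun s : ℝ ↦ z ^ (s : ℂ)) (nhds 1) (nhds (z ^ ((1 : ℝ) : ℂ))) :=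
          (Complex.continuous_ofReal.const_cpow (Or.inl hz)).tendsto 1
        simp only [Complex.ofReal_one, Complex.cpow_one] at h1
        exact (tendsto_const_nhds.div h1 hz).mono_left nhdsWithin_le_nhds
      exact ((hc _ hu).sub (hc _ hv)).div_const 2)
    (by
      filter_upwards [hmem] with s hs n using hle s hs.1.le hs.2 n)
  rw [(hasSum_one_div_sub_one_div_cot ha).tsum_eq] at hdom
  refine tendsto_nhds_unique (hcont.congr' ?_) hdom
  filter_upwards [hmem] with s hs
  exact (HurwitzZeta.hasSum_nat_hurwitzZetaOdd_of_mem_Icc ⟨ha.1.le, ha.2.le⟩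
    (by simpa using hs.1)).tsum_eq.symm

lemma sum_zmod_eq_sum_range {N : ℕ} [NeZero N] {M : Type*} [AddCommMonoid M] (f : ZMod N → M) :
    ∑ j, f j = ∑ n ∈ Finset.range N, f (n : ZMod N) :=
  Finset.sum_bij' (fun j _ ↦ j.val) (fun n _ ↦ (n : ZMod N))
    (fun j _ ↦ Finset.mem_range.2 j.val_lt) (fun _ _ ↦ Finset.mem_univ _)
    (fun j _ ↦ ZMod.natCast_zmod_val j)
    (fun n hn ↦ ZMod.val_cast_of_lt (Finset.mem_range.1 hn))
    (fun j _ ↦ by rw [ZMod.natCast_zmod_val])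

lemma sawtooth_of_mem_Ioo {x : ℝ} (hx : x ∈ Set.Ioo (0 : ℝ) 1) : sawtooth x = x - 1 / 2 := by
  have hf : Int.fract x = x := Int.fract_eq_self.2 ⟨hx.1.le, hx.2⟩
  rw [sawtooth, if_neg, hf]
  rintro ⟨n, hn⟩
  rw [← hn, Int.fract_intCast] at hf
  exact hx.1.ne (hf.trans hn)

lemma sawtooth_intCast (n : ℤ) : sawtooth n = 0 := by
  rw [sawtooth, if_pos ⟨n, rfl⟩]

lemma sawtooth_zero : sawtooth 0 = 0 := by
  simpa using sawtooth_intCast 0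

lemma sum_range_natCast_mul_pow (w : ℂ) (n : ℕ) :
    (∑ j ∈ Finset.range n, (j : ℂ) * w ^ j) * (w - 1) ^ 2 = (n - 1) * w ^ (n + 1) - n * w ^ n + w := by
  induction n with
  | zero => simp
  | succ n ih => rw [Finset.sum_range_succ, add_mul, ih]; push_cast; ring

/-- The discrete Fourier transform of `j ↦ B₁(j / N)` is given by cotangents, expressed here
through the odd Hurwitz zeta function at `1`. -/
lemma dft_sawtooth {N : ℕ} [NeZero N] (k : ZMod N) :
    ZMod.dft (fun j : ZMod N ↦ (sawtooth (j.val / N) : ℂ)) k =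
      Complex.I / Real.pi * HurwitzZeta.hurwitzZetaOdd (ZMod.toAddCircle k) 1 := by
  have hN : (N : ℂ) ≠ 0 := NeZero.ne _
  have hNr : (0 : ℝ) < N := by exact_mod_cast Nat.pos_of_ne_zero (NeZero.ne N)
  have hsaw : ∀ n ∈ Finset.range N, (sawtooth (((n : ZMod N).val : ℝ) / N) : ℂ) =
      (n : ℂ) / N - 1 / 2 + if n = 0 then 1 / 2 else 0 := by
    intro n hn
    rw [ZMod.val_cast_of_lt (Finset.mem_range.1 hn)]
    rcases Nat.eq_zero_or_pos n with rfl | h0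
    · simp [sawtooth_zero]
    · have : sawtooth ((n : ℝ) / N) = n / N - 1 / 2 := sawtooth_of_mem_Ioo
        ⟨by positivity, (div_lt_one hNr).2 (by exact_mod_cast Finset.mem_range.1 hn)⟩
      rw [this, if_neg h0.ne']
      push_cast
      ring
  set w : ℂ := ZMod.stdAddChar (-k) with hw
  have hpow : ∀ n : ℕ, ZMod.stdAddChar (-((n : ZMod N) * k)) = w ^ n := by
    intro n
    rw [hw, ← AddChar.map_nsmul_eq_pow, nsmul_eq_mul, mul_neg]
  have hsum : ZMod.dft (fun j : ZMod N ↦ (sawtooth (j.val / N) : ℂ)) k =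
      (∑ n ∈ Finset.range N, (n : ℂ) * w ^ n) / N - (∑ n ∈ Finset.range N, w ^ n) / 2 + 1 / 2 := by
    rw [ZMod.dft_apply, sum_zmod_eq_sum_range]
    have : ∀ n ∈ Finset.range N, ZMod.stdAddChar (-((n : ZMod N) * k)) •
        (sawtooth (((n : ZMod N).val : ℝ) / N) : ℂ) =
        (n : ℂ) * w ^ n / N - w ^ n / 2 + if n = 0 then 1 / 2 else 0 := by
      intro n hn
      rw [hsaw n hn, hpow, smul_eq_mul]
      split_ifs with h
      · simp [h]
      · ring
    rw [Finset.sum_congr rfl this, Finset.sum_add_distrib, Finset.sum_sub_distrib,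
      Finset.sum_div, Finset.sum_div, Finset.sum_ite_eq' (Finset.range N) 0,
      if_pos (Finset.mem_range.2 (Nat.pos_of_ne_zero (NeZero.ne N)))]
  rw [hsum]
  rcases eq_or_ne k 0 with rfl | hk
  · have h0 : HurwitzZeta.hurwitzZetaOdd 0 1 = 0 := by
      have := HurwitzZeta.hurwitzZetaOdd_neg 0 1
      rw [neg_zero] at this
      exact self_eq_neg.1 this
    have hw1 : w = 1 := by simp [hw]
    have hg : (∑ n ∈ Finset.range N, (n : ℂ)) * 2 = N * (N - 1) := by
      have := Finset.sum_range_id_mul_two N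
      obtain ⟨m, hm⟩ := Nat.exists_eq_succ_of_ne_zero (NeZero.ne N)
      have h2 : ((∑ i ∈ Finset.range N, i) * 2 : ℕ) = ((N * (N - 1) : ℕ) : ℂ) := by
        rw [this]
      rw [hm] at h2 ⊢
      push_cast at h2 ⊢
      simpa using h2
    rw [map_zero, h0, hw1, mul_zero]
    simp only [one_pow, mul_one, Finset.sum_const, Finset.card_range, nsmul_eq_mul]
    rw [eq_div_of_mul_eq two_ne_zero hg]
    field_simp
    ring
  · have hw1 : w - 1 ≠ 0 := by
      rw [sub_ne_zero, hw, ← AddChar.map_zero_eq_one (ZMod.stdAddChar (N := N))]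
      exact fun h ↦ hk (neg_eq_zero.1 (ZMod.injective_stdAddChar h))
    have hwN : w ^ N = 1 := by rw [← hpow]; simp
    have hw0 : w ≠ 0 := by
      rintro h
      rw [h, zero_pow (NeZero.ne N)] at hwN
      exact zero_ne_one hwN
    have hg : ∑ n ∈ Finset.range N, w ^ n = 0 := by
      have := geom_sum_mul w N
      rw [hwN, sub_self] at this
      exact (mul_eq_zero.1 this).resolve_right hw1
    have hS : ∑ n ∈ Finset.range N, (n : ℂ) * w ^ n = N / (w - 1) := by
      have := sum_range_natCast_mul_pow w N
      rw [pow_succ w N, hwN] at this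
      rw [eq_div_iff hw1]
      apply mul_right_cancel₀ hw1
      linear_combination this
    have hv : 0 < k.val := Nat.pos_of_ne_zero ((ZMod.val_ne_zero k).2 hk)
    have hwe : Complex.exp (2 * Complex.I * (Real.pi * ((k.val / N : ℝ) : ℂ))) = w⁻¹ := by
      rw [hw, AddChar.map_neg_eq_inv, inv_inv]
      have := ZMod.stdAddChar_coe (N := N) k.val
      rw [Int.cast_natCast, ZMod.natCast_zmod_val] at this
      rw [this]
      congr 1
      push_cast
      ring
    rw [hS, hg, ZMod.toAddCircle_apply, hurwitzZetaOdd_one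
      ⟨by positivity, (div_lt_one hNr).2 (by exact_mod_cast k.val_lt)⟩, Complex.cot_eq_exp_ratio, hwe]
    have hpi : (Real.pi : ℂ) ≠ 0 := by exact_mod_cast Real.pi_ne_zero
    have h1 : 1 - w⁻¹ = (w - 1) / w := by field_simp
    rw [h1]
    field_simp
    ring

lemma gaussSum'_eq_gaussSum {q : ℕ} [NeZero q] (χ : DirichletCharacter ℂ q) :
    gaussSum' q (fun x ↦ (starRingEnd ℂ) (χ x)) = gaussSum χ⁻¹ ZMod.stdAddChar := by
  rw [gaussSum, sum_zmod_eq_sum_range, gaussSum']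
  refine Finset.sum_congr rfl fun n _ ↦ ?_
  have := ZMod.stdAddChar_coe (N := q) n
  rw [Int.cast_natCast] at this
  rw [this, starRingEnd_apply, MulChar.star_apply']
  push_cast
  rfl

/-- The value `L(1, χ)` for an odd primitive character in terms of the generalized Bernoulli
number of the conjugate character. -/
lemma gaussSum'_mul_LFunction_one {q : ℕ} [NeZero q] {χ : DirichletCharacter ℂ q}
    (hp : χ.IsPrimitive) (ho : χ (-1) = -1) :
    gaussSum' q (fun x ↦ (starRingEnd ℂ) (χ x)) * χ.LFunction 1 =
      -(Real.pi * Complex.I) *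
        ∑ n ∈ Finset.range q, (starRingEnd ℂ) (χ n) * (sawtooth (n / q) : ℂ) := by
  have hq : (q : ℂ) ≠ 0 := NeZero.ne _
  have hpi : (Real.pi : ℂ) ≠ 0 := by exact_mod_cast Real.pi_ne_zero
  have hodd : χ.Odd := ho
  have hp' : χ⁻¹.IsPrimitive := by
    rw [DirichletCharacter.isPrimitive_def, DirichletCharacter.conductor_inv]; exact hp
  set B : ZMod q → ℂ := fun j ↦ (sawtooth (j.val / q) : ℂ) with hB
  set H : ZMod q → ℂ := fun j ↦ HurwitzZeta.hurwitzZetaOdd (ZMod.toAddCircle j) 1 with hH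
  have hdB : H = (-(Complex.I * Real.pi) : ℂ) • ZMod.dft B := by
    funext k
    rw [Pi.smul_apply, dft_sawtooth, smul_eq_mul]
    have : -(Complex.I * Real.pi) * (Complex.I / Real.pi) = 1 := by
      field_simp
      simp
    rw [← mul_assoc, this, one_mul]
  have hdH : ∀ k, ZMod.dft H k = -(Complex.I * Real.pi) * q * B (-k) := by
    intro k
    rw [hdB, map_smul, ZMod.dft_dft, Pi.smul_apply, smul_eq_mul, smul_eq_mul, mul_assoc]
  have hL : χ.LFunction 1 = (q : ℂ)⁻¹ * ∑ j, χ j * H j := by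
    rw [DirichletCharacter.LFunction, ZMod.LFunction_def_odd hodd.to_fun, Complex.cpow_neg_one]
  have hparse : ∑ k, ZMod.dft ⇑(χ⁻¹) k * H k = ∑ k, χ⁻¹ k * ZMod.dft H k := by
    simp only [ZMod.dft_apply, Finset.sum_mul, Finset.mul_sum, smul_eq_mul]
    rw [Finset.sum_comm]
    refine Finset.sum_congr rfl fun i _ ↦ Finset.sum_congr rfl fun j _ ↦ ?_
    rw [mul_comm i j]
    ring
  have hinv : ∀ k, χ⁻¹ (-k) = -χ⁻¹ k := by
    intro k
    rw [← MulChar.star_apply', ← MulChar.star_apply', hodd.eval_neg, star_neg]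
  have h1 : ∑ k, ZMod.dft ⇑(χ⁻¹) k * H k =
      -gaussSum χ⁻¹ ZMod.stdAddChar * ∑ j, χ j * H j := by
    rw [Finset.mul_sum]
    refine Finset.sum_congr rfl fun k _ ↦ ?_
    rw [hp'.fourierTransform_eq_inv_mul_gaussSum, inv_inv, hodd.eval_neg]
    ring
  have h2 : ∑ k, χ⁻¹ k * ZMod.dft H k = Complex.I * Real.pi * q * ∑ k, χ⁻¹ k * B k := by
    rw [← Equiv.sum_comp (Equiv.neg (ZMod q)), Finset.mul_sum]
    refine Finset.sum_congr rfl fun k _ ↦ ?_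
    rw [hdH, Equiv.neg_apply, neg_neg, hinv]
    ring
  have h3 : ∑ k, χ⁻¹ k * B k =
      ∑ n ∈ Finset.range q, (starRingEnd ℂ) (χ n) * (sawtooth (n / q) : ℂ) := by
    rw [sum_zmod_eq_sum_range]
    refine Finset.sum_congr rfl fun n hn ↦ ?_
    rw [starRingEnd_apply, MulChar.star_apply', hB]
    simp only
    rw [ZMod.val_cast_of_lt (Finset.mem_range.1 hn)]
  rw [gaussSum'_eq_gaussSum, hL, ← h3]
  have h4 := h1.symm.trans (hparse.trans h2)
  field_simp
  linear_combination -h4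

lemma sawtooth_add_intCast (x : ℝ) (n : ℤ) : sawtooth (x + n) = sawtooth x := by
  have h : (∃ m : ℤ, (m : ℝ) = x + n) ↔ ∃ m : ℤ, (m : ℝ) = x :=
    ⟨fun ⟨m, hm⟩ ↦ ⟨m - n, by push_cast; linarith⟩, fun ⟨m, hm⟩ ↦ ⟨m + n, by push_cast; linarith⟩⟩
  simp only [sawtooth, h, Int.fract_add_intCast]

lemma sawtooth_eq_of_sub_eq {x y : ℝ} (n : ℤ) (h : x - y = n) : sawtooth x = sawtooth y := by
  rw [← sawtooth_add_intCast y n, ← h, add_sub_cancel]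

lemma sawtooth_neg (x : ℝ) : sawtooth (-x) = -sawtooth x := by
  have h : (∃ m : ℤ, (m : ℝ) = -x) ↔ ∃ m : ℤ, (m : ℝ) = x :=
    ⟨fun ⟨m, hm⟩ ↦ ⟨-m, by push_cast; linarith⟩, fun ⟨m, hm⟩ ↦ ⟨-m, by push_cast; linarith⟩⟩
  simp only [sawtooth, h]
  split_ifs with hx
  · simp
  · rw [Int.fract_neg fun h0 ↦ hx (Int.fract_eq_zero_iff.1 h0)]
    ring

lemma sq_sawtooth_add_sub_sawtooth_add {x y : ℝ} (hx : ¬∃ n : ℤ, (n : ℝ) = x)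
    (hy : ¬∃ n : ℤ, (n : ℝ) = y) (hxy : ¬∃ n : ℤ, (n : ℝ) = x + y) :
    (sawtooth x + sawtooth y - sawtooth (x + y)) ^ 2 = 1 / 4 := by
  rw [sawtooth, sawtooth, sawtooth, if_neg hx, if_neg hy, if_neg hxy]
  obtain ⟨z, hz⟩ := Int.fract_add x y
  have h1 := Int.fract_nonneg (x + y)
  have h2 := Int.fract_lt_one (x + y)
  have h3 := Int.fract_nonneg x
  have h4 := Int.fract_lt_one x
  have h5 := Int.fract_nonneg y
  have h6 := Int.fract_lt_one y
  have hz1 : (z : ℝ) < 1 := by linarith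
  have hz2 : (-2 : ℝ) < z := by linarith
  have hz1' : z < 1 := by exact_mod_cast hz1
  have hz2' : -2 < z := by exact_mod_cast hz2
  obtain rfl | rfl : z = 0 ∨ z = -1 := by omega
  all_goals
    rw [sub_sub, sub_eq_iff_eq_add] at hz
    rw [hz]
    push_cast
    ring

/-- A sum over a full period is invariant under invertible affine changes of variable. -/
lemma sum_range_affine_of_periodic {M : Type*} [AddCommMonoid M] {N : ℕ} {F : ℤ → M}
    (hF : ∀ i, F (i + N) = F i) {u : ℤ} (hu : IsCoprime u N) (t : ℤ) :
    ∑ i ∈ Finset.range N, F (u * i + t) = ∑ i ∈ Finset.range N, F i := by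
  rcases Nat.eq_zero_or_pos N with rfl | hN
  · simp
  have : NeZero N := ⟨hN.ne'⟩
  have hper : ∀ i : ℤ, F i = F ((i : ZMod N).val : ℤ) := by
    intro i
    rw [ZMod.val_intCast]
    have := Function.Periodic.sub_zsmul_eq (f := F) (c := (N : ℤ)) hF (i / N) (x := i)
    rw [← this, Int.emod_def, smul_eq_mul, mul_comm]
  let e : ZMod N ≃ ZMod N :=
    (Units.mulLeft ((ZMod.coe_int_isUnit_iff_isCoprime u N).2 hu.symm).unit).trans
      (Equiv.addRight (t : ZMod N))
  have h1 := sum_zmod_eq_sum_range fun z : ZMod N ↦ F ((e z).val : ℤ)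
  have h2 := sum_zmod_eq_sum_range fun z : ZMod N ↦ F (z.val : ℤ)
  rw [Equiv.sum_comp e fun z : ZMod N ↦ F (z.val : ℤ), h2] at h1
  convert h1.symm using 2 with i _ i _
  · rw [hper]
    congr 3
    simp [e]
  · rw [hper]; simp

/-- The distribution relation for the sawtooth function. -/
lemma sum_sawtooth_add_div {h : ℕ} (hh : 0 < h) (x : ℝ) :
    ∑ j ∈ Finset.range h, sawtooth ((x + j) / h) = sawtooth x := by
  have hh' : (0 : ℝ) < h := by exact_mod_cast hh
  have hsum : (∑ j ∈ Finset.range h, (j : ℝ)) = h * (h - 1) / 2 := by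
    rw [eq_div_iff two_ne_zero]
    have := congrArg (Nat.cast (R := ℝ)) (Finset.sum_range_id_mul_two h)
    rw [Nat.cast_mul, Nat.cast_mul, Nat.cast_sub hh] at this
    push_cast at this
    exact this
  have hper : ∑ j ∈ Finset.range h, sawtooth ((x + j) / h) =
      ∑ j ∈ Finset.range h, sawtooth ((Int.fract x + j) / h) := by
    have := sum_range_affine_of_periodic (N := h)
      (F := fun j : ℤ ↦ sawtooth ((Int.fract x + j) / h))
      (fun i ↦ sawtooth_eq_of_sub_eq 1 (by push_cast; field_simp; ring)) isCoprime_one_left ⌊x⌋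
    simp only [Int.cast_add, Int.cast_natCast, one_mul] at this
    rw [← this]
    refine Finset.sum_congr rfl fun j _ ↦ ?_
    congr 2
    linarith [Int.floor_add_fract x]
  have hfr : sawtooth x = sawtooth (Int.fract x) :=
    sawtooth_eq_of_sub_eq ⌊x⌋ (by linarith [Int.floor_add_fract x])
  rw [hper, hfr]
  have h0 := Int.fract_nonneg x
  have h1 := Int.fract_lt_one x
  generalize Int.fract x = y at h0 h1 ⊢
  rcases h0.eq_or_lt with rfl | h0
  · have hsaw : ∀ j ∈ Finset.range h, sawtooth ((0 + j) / h) =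
        (j : ℝ) / h - 1 / 2 + if j = 0 then 1 / 2 else 0 := by
      intro j hj
      rcases Nat.eq_zero_or_pos j with rfl | hj0
      · simp [sawtooth_zero]
      · rw [zero_add, if_neg hj0.ne', add_zero]
        exact sawtooth_of_mem_Ioo
          ⟨by positivity, (div_lt_one hh').2 (by exact_mod_cast Finset.mem_range.1 hj)⟩
    rw [Finset.sum_congr rfl hsaw, Finset.sum_add_distrib, Finset.sum_sub_distrib,
      ← Finset.sum_div, hsum, Finset.sum_ite_eq' (Finset.range h) 0,
      if_pos (Finset.mem_range.2 hh), sawtooth_zero, Finset.sum_const, Finset.card_range,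
      nsmul_eq_mul]
    field_simp
    ring
  · have hsaw : ∀ j ∈ Finset.range h, sawtooth ((y + j) / h) = y / h + j / h - 1 / 2 := by
      intro j hj
      have hj' : (j : ℝ) + 1 ≤ h := by exact_mod_cast Finset.mem_range.1 hj
      rw [← add_div]
      exact sawtooth_of_mem_Ioo ⟨by positivity, (div_lt_one hh').2 (by linarith)⟩
    rw [Finset.sum_congr rfl hsaw, Finset.sum_sub_distrib, Finset.sum_add_distrib,
      ← Finset.sum_div _ fun j : ℕ ↦ (j : ℝ), hsum, sawtooth_of_mem_Ioo ⟨h0, h1⟩, Finset.sum_const, Finset.sum_const,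
      Finset.card_range, nsmul_eq_mul, nsmul_eq_mul]
    field_simp
    ring

/-- The generalized Dedekind sum of Rademacher, with real shifts `x` and `y`. -/
noncomputable def shiftedDedekindSum (h : ℤ) (k : ℕ) (x y : ℝ) : ℝ :=
  ∑ i ∈ Finset.range k, sawtooth ((i + y) / k) * sawtooth (h * (i + y) / k + x)

lemma shiftedDedekindSum_add_intCast_left (h : ℤ) (k : ℕ) (x y : ℝ) (n : ℤ) :
    shiftedDedekindSum h k (x + n) y = shiftedDedekindSum h k x y := by
  simp only [shiftedDedekindSum, ← add_assoc, sawtooth_add_intCast]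

lemma shiftedDedekindSum_add_intCast_right (h : ℤ) {k : ℕ} (hk : 0 < k) (x y : ℝ) (n : ℤ) :
    shiftedDedekindSum h k x (y + n) = shiftedDedekindSum h k x y := by
  have hk' : (k : ℝ) ≠ 0 := by exact_mod_cast hk.ne'
  have := sum_range_affine_of_periodic (N := k)
    (F := fun i : ℤ ↦ sawtooth ((i + y) / k) * sawtooth (h * (i + y) / k + x))
    (fun i ↦ congrArg₂ _ (sawtooth_eq_of_sub_eq 1 (by push_cast; field_simp; ring))
      (sawtooth_eq_of_sub_eq h (by push_cast; field_simp; ring))) isCoprime_one_left n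
  simp only [Int.cast_add, Int.cast_natCast, one_mul] at this
  rw [shiftedDedekindSum, shiftedDedekindSum, ← this]
  refine Finset.sum_congr rfl fun i _ ↦ ?_
  rw [show (i : ℝ) + n + y = i + (y + n) by ring]

lemma shiftedDedekindSum_neg (h : ℤ) (k : ℕ) (x y : ℝ) :
    shiftedDedekindSum (-h) k (-x) y = -shiftedDedekindSum h k x y := by
  rw [shiftedDedekindSum, shiftedDedekindSum, ← Finset.sum_neg_distrib]
  refine Finset.sum_congr rfl fun i _ ↦ ?_
  rw [← mul_neg, ← sawtooth_neg]
  congr 2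
  push_cast
  ring

/-- Exchanging the two sawtooth factors replaces `u` by its inverse modulo `k`. -/
lemma shiftedDedekindSum_swap {u v e : ℤ} {k : ℕ} (hk : 0 < k) (huv : u * v = 1 + k * e)
    (x y : ℝ) :
    shiftedDedekindSum u k x y = shiftedDedekindSum v k (-e * y - v * x) (u * y + k * x) := by
  have hk' : (k : ℝ) ≠ 0 := by exact_mod_cast hk.ne'
  have huv' : (u : ℝ) * v = 1 + k * e := by exact_mod_cast huv
  have := sum_range_affine_of_periodic (N := k) (u := u)
    (F := fun i : ℤ ↦ sawtooth ((i + (u * y + k * x)) / k) *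
      sawtooth (v * (i + (u * y + k * x)) / k + (-e * y - v * x)))
    (fun i ↦ congrArg₂ _ (sawtooth_eq_of_sub_eq 1 (by push_cast; field_simp; ring))
      (sawtooth_eq_of_sub_eq v (by push_cast; field_simp; ring)))
    ⟨v, -e, by linear_combination huv⟩ 0
  rw [shiftedDedekindSum, shiftedDedekindSum]
  simp only [Int.cast_natCast] at this
  rw [← this]
  refine Finset.sum_congr rfl fun i _ ↦ ?_
  rw [mul_comm]
  refine congrArg₂ _ ?_ (sawtooth_eq_of_sub_eq (-(e * i)) ?_)
  · congr 1
    push_cast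
    field_simp
    ring
  · push_cast
    field_simp
    linear_combination -(i + y : ℝ) * huv'

/-- The reciprocity law for shifted Dedekind sums, up to terms depending on only one of the two
shifts. -/
lemma exists_shiftedDedekindSum_reciprocity {h k : ℕ} (hh : 0 < h) (hk : 0 < k)
    (hhk : Nat.Coprime h k) : ∃ f g : ℝ → ℝ, ∀ x y : ℝ, (¬∃ n : ℤ, (n : ℝ) = x) →
      (¬∃ n : ℤ, (n : ℝ) = y) → (∃ n : ℤ, (n : ℝ) = k * x) → (¬∃ n : ℤ, (n : ℝ) = h * y) →
      shiftedDedekindSum h k x y + shiftedDedekindSum k h y x =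
        sawtooth x * sawtooth y + f x + g y := by
  have hh' : (h : ℝ) ≠ 0 := by exact_mod_cast hh.ne'
  have hk' : (k : ℝ) ≠ 0 := by exact_mod_cast hk.ne'
  refine ⟨fun x ↦ k / 2 * ∑ j ∈ Finset.range h, sawtooth ((j + x) / h) ^ 2,
    fun y ↦ h / 2 * (∑ i ∈ Finset.range k, sawtooth ((i + y) / k) ^ 2) - h * k / 8 +
      (∑ i ∈ Finset.range k, ∑ j ∈ Finset.range h, sawtooth ((i + y) / k + j / h) ^ 2) / 2,
    fun x y hx hy ⟨s, hs⟩ hhy ↦ ?_⟩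
  have hX : ∀ i : ℕ, ¬∃ n : ℤ, (n : ℝ) = (i + y) / k := fun i ⟨n, hn⟩ ↦ hy ⟨n * k - i, by
    push_cast; rw [hn]; field_simp; ring⟩
  have hY : ∀ j : ℕ, ¬∃ n : ℤ, (n : ℝ) = (j + x) / h := fun j ⟨n, hn⟩ ↦ hx ⟨n * h - j, by
    push_cast; rw [hn]; field_simp; ring⟩
  have hXY : ∀ i j : ℕ, ¬∃ n : ℤ, (n : ℝ) = (i + y) / k + (j + x) / h := fun i j ⟨n, hn⟩ ↦
    hhy ⟨n * h * k - h * i - k * j - s, by push_cast; rw [hn, hs]; field_simp; ring⟩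
  have hsq : ∑ i ∈ Finset.range k, ∑ j ∈ Finset.range h, (sawtooth ((i + y) / k) +
      sawtooth ((j + x) / h) - sawtooth ((i + y) / k + (j + x) / h)) ^ 2 = h * k / 4 := by
    simp only [sq_sawtooth_add_sub_sawtooth_add (hX _) (hY _) (hXY _ _), Finset.sum_const,
      Finset.card_range, nsmul_eq_mul]
    ring
  have hexp : ∀ i j : ℕ, (sawtooth ((i + y) / k) +
      sawtooth ((j + x) / h) - sawtooth ((i + y) / k + (j + x) / h)) ^ 2 =
      sawtooth ((i + y) / k) ^ 2 + sawtooth ((j + x) / h) ^ 2 +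
      sawtooth ((i + y) / k + (j + x) / h) ^ 2 +
      2 * (sawtooth ((i + y) / k) * sawtooth ((j + x) / h)) -
      2 * (sawtooth ((i + y) / k) * sawtooth ((i + y) / k + (j + x) / h)) -
      2 * (sawtooth ((j + x) / h) * sawtooth ((i + y) / k + (j + x) / h)) := fun i j ↦ by ring
  have hdist : ∀ {l : ℕ}, 0 < l → ∀ z : ℝ,
      ∑ j ∈ Finset.range l, sawtooth ((j + z) / l) = sawtooth z := by
    intro l hl z
    simp only [add_comm _ z, sum_sawtooth_add_div hl]
  have hD₁ : ∑ i ∈ Finset.range k, ∑ j ∈ Finset.range h,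
      sawtooth ((i + y) / k) * sawtooth ((i + y) / k + (j + x) / h) =
      shiftedDedekindSum h k x y := by
    rw [shiftedDedekindSum]
    refine Finset.sum_congr rfl fun i _ ↦ ?_
    rw [← Finset.mul_sum, ← hdist hh (((h : ℤ) : ℝ) * (i + y) / k + x)]
    refine congrArg _ (Finset.sum_congr rfl fun j _ ↦ congrArg _ ?_)
    push_cast
    field_simp
    ring
  have hD₂ : ∑ i ∈ Finset.range k, ∑ j ∈ Finset.range h,
      sawtooth ((j + x) / h) * sawtooth ((i + y) / k + (j + x) / h) =
      shiftedDedekindSum k h y x := by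
    rw [shiftedDedekindSum, Finset.sum_comm]
    refine Finset.sum_congr rfl fun i _ ↦ ?_
    rw [← Finset.mul_sum, ← hdist hk (((k : ℤ) : ℝ) * (i + x) / h + y)]
    refine congrArg _ (Finset.sum_congr rfl fun j _ ↦ congrArg _ ?_)
    push_cast
    field_simp
    ring
  have hP : ∑ i ∈ Finset.range k, ∑ j ∈ Finset.range h,
      sawtooth ((i + y) / k) * sawtooth ((j + x) / h) = sawtooth y * sawtooth x := by
    simp only [← Finset.mul_sum, ← Finset.sum_mul, hdist hh, hdist hk]
  have hQ : ∑ i ∈ Finset.range k, ∑ j ∈ Finset.range h,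
      sawtooth ((i + y) / k + (j + x) / h) ^ 2 =
      ∑ i ∈ Finset.range k, ∑ j ∈ Finset.range h, sawtooth ((i + y) / k + j / h) ^ 2 := by
    obtain ⟨p, q, hpq⟩ := Nat.isCoprime_iff_coprime.2 hhk
    have hpq' : (p : ℝ) * h + q * k = 1 := by exact_mod_cast hpq
    have h1 := sum_range_affine_of_periodic (N := k) (u := 1)
      (F := fun i : ℤ ↦ ∑ j ∈ Finset.range h, sawtooth ((i + y) / k + j / h) ^ 2)
      (fun i ↦ Finset.sum_congr rfl fun j _ ↦ congrArg (· ^ 2)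
        (sawtooth_eq_of_sub_eq 1 (by push_cast; field_simp; ring))) isCoprime_one_left (s * p)
    simp only [Int.cast_natCast] at h1
    rw [← h1]
    refine Finset.sum_congr rfl fun i _ ↦ ?_
    have h2 := sum_range_affine_of_periodic (N := h) (u := 1)
      (F := fun j : ℤ ↦ sawtooth ((((1 * i + s * p : ℤ) : ℝ) + y) / k + j / h) ^ 2)
      (fun i ↦ congrArg (· ^ 2)
        (sawtooth_eq_of_sub_eq 1 (by push_cast; field_simp; ring))) isCoprime_one_left (s * q)
    simp only [Int.cast_natCast] at h2
    rw [← h2]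
    refine Finset.sum_congr rfl fun j _ ↦ congrArg (sawtooth · ^ 2) ?_
    push_cast
    rw [hs]
    field_simp
    linear_combination (-k * x) * hpq'
  simp only [← Finset.mul_sum] at hD₁ hP
  simp only [hexp, Finset.sum_add_distrib, Finset.sum_sub_distrib, ← Finset.mul_sum, hD₁, hD₂, hP,
    hQ, Finset.sum_const, Finset.card_range, nsmul_eq_mul] at hsq
  linear_combination -hsq / 2

/-- The sum `∑ conj χ₂(m) conj χ₁(n) D(h, k; n / q₁, m / q₂)` of shifted Dedekind sums. -/
noncomputable def twistedDedekindSum {q₁ q₂ : ℕ} (χ₁ : DirichletCharacter ℂ q₁)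
    (χ₂ : DirichletCharacter ℂ q₂) (h : ℤ) (k : ℕ) : ℂ :=
  ∑ m ∈ Finset.range q₂, (starRingEnd ℂ) (χ₂ m) * ∑ n ∈ Finset.range q₁,
    (starRingEnd ℂ) (χ₁ n) * (shiftedDedekindSum h k (n / q₁) (m / q₂) : ℂ)

/-- The generalized Bernoulli number `B_{1, conj χ}`. -/
noncomputable def bernoulliOneConj {q : ℕ} (χ : DirichletCharacter ℂ q) : ℂ :=
  ∑ n ∈ Finset.range q, (starRingEnd ℂ) (χ n) * (sawtooth (n / q) : ℂ)

lemma sum_range_mul_eq {M : Type*} [AddCommMonoid M] (f : ℕ → M) (q k : ℕ) :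
    ∑ j ∈ Finset.range (q * k), f j =
      ∑ m ∈ Finset.range q, ∑ i ∈ Finset.range k, f (m + q * i) := by
  induction k with
  | zero => simp
  | succ k ih =>
    rw [Nat.mul_succ, Finset.sum_range_add, ih]
    simp only [Finset.sum_range_succ, Finset.sum_add_distrib, add_comm (q * k)]

lemma newformDedekindSum_eq_twistedDedekindSum {q₁ q₂ : ℕ} [NeZero q₂]
    (χ₁ : DirichletCharacter ℂ q₁) (χ₂ : DirichletCharacter ℂ q₂) (h : ℤ) {k : ℕ} (hk : 0 < k) :
    newformDedekindSum χ₁ χ₂ h ((q₂ * k : ℕ) : ℤ) = twistedDedekindSum χ₁ χ₂ h k := by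
  have hq : (q₂ : ℝ) ≠ 0 := NeZero.ne _
  have hk' : (k : ℝ) ≠ 0 := by exact_mod_cast hk.ne'
  rw [newformDedekindSum, Int.toNat_natCast, sum_range_mul_eq, twistedDedekindSum]
  refine Finset.sum_congr rfl fun m _ ↦ ?_
  rw [Finset.sum_comm, Finset.mul_sum]
  refine Finset.sum_congr rfl fun n _ ↦ ?_
  rw [shiftedDedekindSum, Complex.ofReal_sum, Finset.mul_sum, Finset.mul_sum]
  refine Finset.sum_congr rfl fun i _ ↦ ?_
  have h1 : ((m + q₂ * i : ℕ) : ZMod q₂) = m := by simp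
  have h2 : ((m + q₂ * i : ℕ) : ℝ) / ((q₂ * k : ℕ) : ℤ) = (i + m / q₂) / k := by
    push_cast
    field_simp
    ring
  rw [mul_div_assoc, h1, h2, mul_div_assoc, add_comm (n / q₁ : ℝ)]
  push_cast
  ring

/-- Twisting a change of variable `m ↦ v * m` by a character. -/
lemma sum_conj_mul_comp_mul {q : ℕ} (χ : DirichletCharacter ℂ q) {v : ℤ} (hv : IsCoprime v q)
    {G : ℤ → ℂ} (hG : ∀ i, G (i + q) = G i) :
    ∑ m ∈ Finset.range q, (starRingEnd ℂ) (χ m) * G (v * m) =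
      χ v * ∑ m ∈ Finset.range q, (starRingEnd ℂ) (χ m) * G m := by
  have hu : IsUnit (v : ZMod q) := (ZMod.coe_int_isUnit_iff_isCoprime v q).2 hv.symm
  have h1 : χ v * (starRingEnd ℂ) (χ v) = 1 := by
    rw [Complex.mul_conj, Complex.normSq_eq_norm_sq, ← hu.unit_spec, χ.unit_norm_eq_one]
    simp
  have h2 := sum_range_affine_of_periodic (N := q)
    (F := fun m : ℤ ↦ (starRingEnd ℂ) (χ m) * G m) (fun i ↦ by simp [hG]) hv 0
  simp only [Int.cast_natCast] at h2
  rw [← h2, Finset.mul_sum]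
  refine Finset.sum_congr rfl fun m _ ↦ ?_
  rw [add_zero, Int.cast_mul, map_mul, map_mul, Int.cast_natCast]
  linear_combination -(starRingEnd ℂ) (χ m) * G (v * m) * h1

lemma sum_shiftedDedekindSum_comp_mul {q₁ q₂ : ℕ} [NeZero q₁] [NeZero q₂]
    (χ₁ : DirichletCharacter ℂ q₁) (χ₂ : DirichletCharacter ℂ q₂) (h : ℤ) {k : ℕ} (hk : 0 < k)
    {u v : ℤ} (hu : IsCoprime u q₁) (hv : IsCoprime v q₂) :
    ∑ m ∈ Finset.range q₂, (starRingEnd ℂ) (χ₂ m) * ∑ n ∈ Finset.range q₁,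
      (starRingEnd ℂ) (χ₁ n) * (shiftedDedekindSum h k (u * n / q₁) (v * m / q₂) : ℂ) =
      χ₁ u * χ₂ v * twistedDedekindSum χ₁ χ₂ h k := by
  have hq₁ : (q₁ : ℝ) ≠ 0 := NeZero.ne _
  have hq₂ : (q₂ : ℝ) ≠ 0 := NeZero.ne _
  have h1 : ∀ y : ℝ, ∑ n ∈ Finset.range q₁,
      (starRingEnd ℂ) (χ₁ n) * (shiftedDedekindSum h k (u * n / q₁) y : ℂ) =
      χ₁ u * ∑ n ∈ Finset.range q₁,
        (starRingEnd ℂ) (χ₁ n) * (shiftedDedekindSum h k (n / q₁) y : ℂ) := by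
    intro y
    have := sum_conj_mul_comp_mul χ₁ hu
      (G := fun n ↦ (shiftedDedekindSum h k (n / q₁) y : ℂ)) (fun i ↦ by
        have := shiftedDedekindSum_add_intCast_left h k (i / q₁) y 1
        push_cast at this ⊢
        rw [add_div, div_self hq₁, this])
    push_cast at this
    exact this
  have h2 := sum_conj_mul_comp_mul χ₂ hv
    (G := fun m ↦ ∑ n ∈ Finset.range q₁,
      (starRingEnd ℂ) (χ₁ n) * (shiftedDedekindSum h k (n / q₁) (m / q₂) : ℂ)) (fun i ↦ by
        refine Finset.sum_congr rfl fun n _ ↦ ?_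
        have := shiftedDedekindSum_add_intCast_right h hk (n / q₁) (i / q₂) 1
        push_cast at this ⊢
        rw [add_div, div_self hq₂, this])
  push_cast at h2
  rw [twistedDedekindSum, mul_assoc, ← h2, Finset.mul_sum]
  refine Finset.sum_congr rfl fun m _ ↦ ?_
  rw [h1]
  ring

lemma twistedDedekindSum_neg {q₁ q₂ : ℕ} [NeZero q₁] [NeZero q₂] {χ₁ : DirichletCharacter ℂ q₁}
    (χ₂ : DirichletCharacter ℂ q₂) (ho₁ : χ₁ (-1) = -1) (h : ℤ) {k : ℕ} (hk : 0 < k) :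
    twistedDedekindSum χ₁ χ₂ (-h) k = twistedDedekindSum χ₁ χ₂ h k := by
  have := sum_shiftedDedekindSum_comp_mul χ₁ χ₂ h hk (u := -1) (v := 1)
    isCoprime_one_left.neg_left isCoprime_one_left
  simp only [Int.cast_neg, Int.cast_one, ho₁, map_one, neg_mul, one_mul] at this
  rw [← neg_eq_iff_eq_neg] at this
  rw [← this, twistedDedekindSum, ← Finset.sum_neg_distrib]
  refine Finset.sum_congr rfl fun m _ ↦ ?_
  rw [← mul_neg, ← Finset.sum_neg_distrib]
  congr 1
  refine Finset.sum_congr rfl fun n _ ↦ ?_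
  have h1 := shiftedDedekindSum_neg h k (-(n / q₁)) (m / q₂)
  rw [neg_neg] at h1
  rw [h1, neg_div]
  push_cast
  ring

lemma sum_range_conj_eq_zero {q : ℕ} [NeZero q] {χ : DirichletCharacter ℂ q} (hχ : χ ≠ 1) :
    ∑ n ∈ Finset.range q, (starRingEnd ℂ) (χ n) = 0 := by
  rw [← map_sum, ← sum_zmod_eq_sum_range (fun z ↦ χ z), MulChar.sum_eq_zero_of_ne_one hχ, map_zero]

lemma ne_one_of_dirichletCharacter_ne_one {q : ℕ} {χ : DirichletCharacter ℂ q} (hχ : χ ≠ 1) :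
    q ≠ 1 := by
  rintro rfl
  exact hχ χ.level_one

lemma not_exists_intCast_eq_mul_div {q h n : ℕ} [NeZero q] (hq : q ≠ 1) (hh : Nat.Coprime h q)
    (hn : Nat.Coprime n q) : ¬∃ z : ℤ, (z : ℝ) = h * (n / q) := by
  have hq' : (q : ℝ) ≠ 0 := NeZero.ne _
  rintro ⟨z, hz⟩
  have h1 : z * q = (h * n : ℕ) := by
    have : (z : ℝ) * q = (h * n : ℕ) := by rw [hz]; push_cast; field_simp
    exact_mod_cast this
  have h2 : q ∣ h * n := Int.natCast_dvd_natCast.1 ⟨z, by rw [← h1, mul_comm]⟩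
  exact hq (Nat.Coprime.eq_one_of_dvd (Nat.Coprime.mul_left hh hn).symm h2)

lemma twistedDedekindSum_reciprocity {q₁ q₂ : ℕ} [NeZero q₁] [NeZero q₂]
    {χ₁ : DirichletCharacter ℂ q₁} {χ₂ : DirichletCharacter ℂ q₂} (hχ₁ : χ₁ ≠ 1) (hχ₂ : χ₂ ≠ 1)
    {h k : ℕ} (hh : 0 < h) (hk : 0 < k) (hhk : Nat.Coprime h k) (hq₁ : q₁ ∣ k)
    (hq₂ : Nat.Coprime h q₂) :
    twistedDedekindSum χ₁ χ₂ h k + twistedDedekindSum χ₂ χ₁ k h =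
      bernoulliOneConj χ₁ * bernoulliOneConj χ₂ := by
  obtain ⟨f, g, hfg⟩ := exists_shiftedDedekindSum_reciprocity hh hk hhk
  have hterm : ∀ m n : ℕ, (starRingEnd ℂ) (χ₂ m) * ((starRingEnd ℂ) (χ₁ n) *
      (shiftedDedekindSum h k (n / q₁) (m / q₂) : ℂ)) +
      (starRingEnd ℂ) (χ₁ n) * ((starRingEnd ℂ) (χ₂ m) *
        (shiftedDedekindSum k h (m / q₂) (n / q₁) : ℂ)) =
      (starRingEnd ℂ) (χ₁ n) * (sawtooth (n / q₁) : ℂ) *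
        ((starRingEnd ℂ) (χ₂ m) * (sawtooth (m / q₂) : ℂ)) +
      (starRingEnd ℂ) (χ₂ m) * ((starRingEnd ℂ) (χ₁ n) * (f (n / q₁) : ℂ)) +
      (starRingEnd ℂ) (χ₁ n) * ((starRingEnd ℂ) (χ₂ m) * (g (m / q₂) : ℂ)) := by
    intro m n
    by_cases hm : Nat.Coprime m q₂
    · by_cases hn : Nat.Coprime n q₁
      · have hx := not_exists_intCast_eq_mul_div (ne_one_of_dirichletCharacter_ne_one hχ₁)
          (Nat.coprime_one_left q₁) hn
        have hy := not_exists_intCast_eq_mul_div (ne_one_of_dirichletCharacter_ne_one hχ₂)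
          (Nat.coprime_one_left q₂) hm
        simp only [Nat.cast_one, one_mul] at hx hy
        have hkx : ∃ z : ℤ, (z : ℝ) = k * (n / q₁) := by
          obtain ⟨l, rfl⟩ := hq₁
          have : (q₁ : ℝ) ≠ 0 := NeZero.ne _
          exact ⟨l * n, by push_cast; field_simp⟩
        have := hfg (n / q₁) (m / q₂) hx hy hkx
          (not_exists_intCast_eq_mul_div (ne_one_of_dirichletCharacter_ne_one hχ₂) hq₂ hm)
        have h' := congrArg Complex.ofReal this
        push_cast at h'
        linear_combination (starRingEnd ℂ) (χ₁ n) * (starRingEnd ℂ) (χ₂ m) * h'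
      · have : χ₁ n = 0 := χ₁.map_nonunit fun hu ↦ hn ((ZMod.isUnit_iff_coprime n q₁).1 hu)
        simp [this]
    · have : χ₂ m = 0 := χ₂.map_nonunit fun hu ↦ hm ((ZMod.isUnit_iff_coprime m q₂).1 hu)
      simp [this]
  simp only [twistedDedekindSum, Finset.mul_sum]
  rw [Finset.sum_comm (s := Finset.range q₁), ← Finset.sum_add_distrib]
  simp only [← Finset.sum_add_distrib, hterm]
  simp only [Finset.sum_add_distrib]
  have h1 : ∑ m ∈ Finset.range q₂, ∑ n ∈ Finset.range q₁,
      (starRingEnd ℂ) (χ₂ m) * ((starRingEnd ℂ) (χ₁ n) * (f (n / q₁) : ℂ)) = 0 := by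
    rw [← Finset.sum_mul_sum, sum_range_conj_eq_zero hχ₂, zero_mul]
  have h2 : ∑ m ∈ Finset.range q₂, ∑ n ∈ Finset.range q₁,
      (starRingEnd ℂ) (χ₁ n) * ((starRingEnd ℂ) (χ₂ m) * (g (m / q₂) : ℂ)) = 0 := by
    rw [Finset.sum_comm, ← Finset.sum_mul_sum, sum_range_conj_eq_zero hχ₁, zero_mul]
  have h3 : ∑ m ∈ Finset.range q₂, ∑ n ∈ Finset.range q₁,
      (starRingEnd ℂ) (χ₁ n) * (sawtooth (n / q₁) : ℂ) *
        ((starRingEnd ℂ) (χ₂ m) * (sawtooth (m / q₂) : ℂ)) =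
      bernoulliOneConj χ₁ * bernoulliOneConj χ₂ := by
    rw [Finset.sum_comm, ← Finset.sum_mul_sum]
    rfl
  rw [h1, h2, h3, add_zero, add_zero]

/-- Inverting `r * q₁` modulo `α` in a twisted Dedekind sum. -/
lemma twistedDedekindSum_eq_mul_of_mul_sub_mul_eq_one {q₁ q₂ : ℕ} [NeZero q₁] [NeZero q₂]
    (χ₁ : DirichletCharacter ℂ q₁) (χ₂ : DirichletCharacter ℂ q₂) {α : ℕ} (hα : 0 < α)
    {b r δ : ℤ} (hdet : α * δ - (b * q₂) * (r * q₁) = 1) :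
    twistedDedekindSum χ₂ χ₁ (r * q₁) α =
      χ₁ δ * χ₂ α * twistedDedekindSum χ₁ χ₂ (-(b * q₂)) α := by
  have hq₁ : (q₁ : ℝ) ≠ 0 := NeZero.ne _
  have hq₂ : (q₂ : ℝ) ≠ 0 := NeZero.ne _
  have h1 := sum_shiftedDedekindSum_comp_mul χ₁ χ₂ (-(b * q₂)) hα (u := δ) (v := α)
    ⟨α, -(b * q₂ * r), by linear_combination hdet⟩ ⟨δ, -(b * r * q₁), by linear_combination hdet⟩
  simp only [Int.cast_natCast] at h1
  rw [← h1, twistedDedekindSum]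
  simp only [Finset.mul_sum]
  rw [Finset.sum_comm]
  refine Finset.sum_congr rfl fun m _ ↦ Finset.sum_congr rfl fun n _ ↦ ?_
  have h2 := shiftedDedekindSum_swap (u := r * q₁) (v := -(b * q₂)) (e := -δ) hα
    (by linear_combination hdet) (m / q₂) (n / q₁)
  have h3 := shiftedDedekindSum_add_intCast_left (-(b * q₂)) α (δ * n / q₁) (α * m / q₂) (b * m)
  have h4 := shiftedDedekindSum_add_intCast_right (-(b * q₂)) hα (δ * n / q₁ + (b * m : ℤ))
    (α * m / q₂) (r * n)
  have h5 : -((-δ : ℤ) : ℝ) * (n / q₁) - ((-(b * q₂) : ℤ) : ℝ) * (m / q₂) =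
      δ * n / q₁ + (b * m : ℤ) := by
    push_cast
    field_simp
    ring
  have h6 : ((r * q₁ : ℤ) : ℝ) * (n / q₁) + α * (m / q₂) = α * m / q₂ + (r * n : ℤ) := by
    push_cast
    field_simp
    ring
  rw [h2, h5, h6, h4, h3]
  ring

/-- Inverting `α` modulo `β` in a twisted Dedekind sum. -/
lemma twistedDedekindSum_eq_mul_of_mul_eq_one_add_mul {q₁ q₂ : ℕ} [NeZero q₁] [NeZero q₂]
    (χ₁ : DirichletCharacter ℂ q₁) (χ₂ : DirichletCharacter ℂ q₂) {α δ e : ℤ} {β : ℕ}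
    (hβ : 0 < β) (hq₂ : q₂ ∣ β) (hq₁ : (q₁ : ℤ) ∣ e) (hdet : α * δ = 1 + β * e) :
    twistedDedekindSum χ₂ χ₁ α β = χ₂ (-δ : ℤ) * χ₁ α * twistedDedekindSum χ₂ χ₁ δ β := by
  have hq₁' : (q₁ : ℝ) ≠ 0 := NeZero.ne _
  have hq₂' : (q₂ : ℝ) ≠ 0 := NeZero.ne _
  obtain ⟨s, rfl⟩ := hq₂
  obtain ⟨t, rfl⟩ := hq₁
  push_cast at hdet
  have h1 := sum_shiftedDedekindSum_comp_mul χ₂ χ₁ δ hβ (u := -δ) (v := α)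
    ⟨-α, -(s * q₁ * t), by linear_combination hdet⟩
    ⟨δ, -(q₂ * s * t), by linear_combination hdet⟩
  rw [← h1, twistedDedekindSum]
  refine Finset.sum_congr rfl fun m _ ↦ congrArg _ (Finset.sum_congr rfl fun n _ ↦ ?_)
  have h2 := shiftedDedekindSum_swap (u := α) (v := δ) hβ
    (by push_cast; exact hdet) (n / q₂) (m / q₁)
  have h3 := shiftedDedekindSum_add_intCast_left δ (q₂ * s) ((-δ : ℤ) * n / q₂) (α * m / q₁)
    (-t * m)
  have h4 := shiftedDedekindSum_add_intCast_right δ hβ ((-δ : ℤ) * n / q₂ + (-t * m : ℤ))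
    (α * m / q₁) (s * n)
  have h5 : -((q₁ * t : ℤ) : ℝ) * (m / q₁) - δ * (n / q₂) =
      (-δ : ℤ) * n / q₂ + (-t * m : ℤ) := by
    push_cast
    field_simp
    ring
  have h6 : (α : ℝ) * (m / q₁) + (q₂ * s : ℕ) * (n / q₂) = α * m / q₁ + (s * n : ℤ) := by
    push_cast
    field_simp
  rw [h2, h5, h6, h4, h3]

lemma twistedDedekindSum_zero_one {q₁ q₂ : ℕ} (χ₁ : DirichletCharacter ℂ q₁)
    (χ₂ : DirichletCharacter ℂ q₂) :
    twistedDedekindSum χ₁ χ₂ 0 1 = bernoulliOneConj χ₁ * bernoulliOneConj χ₂ := by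
  simp only [twistedDedekindSum, bernoulliOneConj, Finset.sum_mul_sum]
  rw [Finset.sum_comm]
  simp only [Finset.mul_sum]
  refine Finset.sum_congr rfl fun m _ ↦ Finset.sum_congr rfl fun n _ ↦ ?_
  simp [shiftedDedekindSum]
  ring

/-- The reciprocity law for twisted Dedekind sums attached to a matrix of determinant one with
positive upper-left entry. -/
lemma twistedDedekindSum_eq_of_mul_sub_mul_eq_one {q₁ q₂ : ℕ} [NeZero q₁] [NeZero q₂]
    {χ₁ : DirichletCharacter ℂ q₁} {χ₂ : DirichletCharacter ℂ q₂} (hχ₁ : χ₁ ≠ 1) (hχ₂ : χ₂ ≠ 1)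
    (ho₁ : χ₁ (-1) = -1) (ho₂ : χ₂ (-1) = -1) {α r : ℕ} (hα : 0 < α) (hr : 0 < r) {b δ : ℤ}
    (hdet : α * δ - (b * q₂) * (r * q₁) = 1) :
    twistedDedekindSum χ₁ χ₂ α (r * q₁) =
      (1 - χ₁ δ * χ₂ α) * (bernoulliOneConj χ₁ * bernoulliOneConj χ₂) -
        if b = 0 then 0 else twistedDedekindSum χ₂ χ₁ δ (b.natAbs * q₂) := by
  have hC : 0 < r * q₁ := Nat.mul_pos hr (NeZero.pos q₁)
  have h1 := twistedDedekindSum_reciprocity hχ₁ hχ₂ hα hC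
    (Nat.isCoprime_iff_coprime.1 ⟨δ, -(b * q₂), by push_cast; linear_combination hdet⟩)
    (Nat.dvd_mul_left q₁ r)
    (Nat.isCoprime_iff_coprime.1 ⟨δ, -(b * r * q₁), by linear_combination hdet⟩)
  have h2 := twistedDedekindSum_eq_mul_of_mul_sub_mul_eq_one χ₁ χ₂ hα hdet
  push_cast at h1 h2
  rw [h2] at h1
  split_ifs with hb
  · subst hb
    have hα1 : α = 1 := by
      have : (α : ℤ) ∣ 1 := ⟨δ, by linear_combination -hdet⟩
      exact Nat.dvd_one.1 (by exact_mod_cast this)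
    subst hα1
    rw [zero_mul, neg_zero, twistedDedekindSum_zero_one] at h1
    push_cast at h1 ⊢
    linear_combination h1
  · have hβ : 0 < b.natAbs * q₂ := Nat.mul_pos (Int.natAbs_pos.2 hb) (NeZero.pos q₂)
    have hβe : ∃ e : ℤ, (q₁ : ℤ) ∣ e ∧ (α : ℤ) * δ = 1 + (b.natAbs * q₂ : ℕ) * e := by
      refine ⟨b.sign * r * q₁, ⟨b.sign * r, by ring⟩, ?_⟩
      have := Int.sign_mul_natAbs b
      push_cast at this ⊢
      linear_combination hdet - (q₂ * r * q₁ : ℤ) * this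
    obtain ⟨e, hqe, he⟩ := hβe
    have h3 := twistedDedekindSum_reciprocity hχ₂ hχ₁ hα hβ
      (Nat.isCoprime_iff_coprime.1 ⟨δ, -e, by linear_combination he⟩)
      (Nat.dvd_mul_left q₂ _)
      (Nat.isCoprime_iff_coprime.1 ⟨δ, -(b * r * q₂), by linear_combination hdet⟩)
    have h4 := twistedDedekindSum_eq_mul_of_mul_eq_one_add_mul χ₁ χ₂ hβ
      (Nat.dvd_mul_left q₂ _) hqe he
    have h5 : twistedDedekindSum χ₁ χ₂ (-(b * q₂)) α =
        twistedDedekindSum χ₁ χ₂ (b.natAbs * q₂ : ℕ) α := by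
      rcases Int.natAbs_eq b with hb' | hb'
      · rw [twistedDedekindSum_neg χ₂ ho₁ _ hα]
        congr 1
        push_cast
        rw [← Int.natCast_natAbs, ← hb']
      · congr 1
        push_cast
        rw [← Int.natCast_natAbs]
        linear_combination -(q₂ : ℤ) * hb'
    have h6 : χ₁ δ * χ₁ α = 1 := by
      have := congrArg (Int.cast (R := ZMod q₁)) hdet
      push_cast at this
      rw [← map_mul, show (δ * α : ZMod q₁) = 1 by simpa [mul_comm] using this, map_one]
    have h7 : χ₂ (-δ : ℤ) * χ₂ α = -1 := by
      have := congrArg (Int.cast (R := ZMod q₂)) hdet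
      push_cast at this ⊢
      rw [← map_mul, show (-δ * α : ZMod q₂) = -1 by
        rw [neg_mul, mul_comm]; simpa using this, ho₂]
    rw [h5] at h1
    simp only [Int.cast_natCast] at h3 h4
    rw [h4] at h3
    linear_combination h1 - χ₁ δ * χ₂ α * h3 + twistedDedekindSum χ₂ χ₁ δ (b.natAbs * q₂) *
      (χ₂ (-δ : ℤ) * χ₂ α * h6 + h7)

theorem newform_dedekind_sum_reciprocity_odd {q₁ q₂ : ℕ} [NeZero q₁] [NeZero q₂]
    (χ₁ : DirichletCharacter ℂ q₁) (χ₂ : DirichletCharacter ℂ q₂)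
    (hχ₁ : χ₁ ≠ 1) (hχ₂ : χ₂ ≠ 1) (hp₁ : χ₁.IsPrimitive) (hp₂ : χ₂.IsPrimitive)
    (ho₁ : χ₁ (-1) = -1) (ho₂ : χ₂ (-1) = -1)
    (γ γ' : Matrix.SpecialLinearGroup (Fin 2) ℤ) (hγ : InGamma0 (q₁ * q₂) γ)
    (r : ℤ) (hr : 1 ≤ r) (hc : γ.1 1 0 = r * ((q₁ : ℤ) * (q₂ : ℤ)))
    (h'a : γ'.1 0 0 = γ.1 1 1) (h'b : γ'.1 0 1 = -r)
    (h'c : γ'.1 1 0 = -(γ.1 0 1) * ((q₁ : ℤ) * (q₂ : ℤ))) (h'd : γ'.1 1 1 = γ.1 0 0) :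
    newformDedekindSumSL χ₁ χ₂ γ = -newformDedekindSumSL χ₂ χ₁ γ' +
      (1 - χ₁ ((γ.1 1 1 : ℤ) : ZMod q₁) * (starRingEnd ℂ) (χ₂ ((γ.1 1 1 : ℤ) : ZMod q₂))) *
        (gaussSum' q₁ (fun x => (starRingEnd ℂ) (χ₁ x)) *
          gaussSum' q₂ (fun x => (starRingEnd ℂ) (χ₂ x)) /
            ((Real.pi : ℂ) * Complex.I) ^ 2) *
        χ₁.LFunction 1 * χ₂.LFunction 1 := by
  obtain ⟨a, ha⟩ : ∃ a, γ.1 0 0 = a := ⟨_, rfl⟩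
  obtain ⟨b, hb⟩ : ∃ b, γ.1 0 1 = b := ⟨_, rfl⟩
  obtain ⟨d, hd⟩ : ∃ d, γ.1 1 1 = d := ⟨_, rfl⟩
  lift r to ℕ using by omega
  have hr' : 0 < r := by omega
  have hq₁ : 0 < q₁ := NeZero.pos q₁
  have hq₂ : 0 < q₂ := NeZero.pos q₂
  have hdet : a * d - (b * q₂) * (r * q₁) = 1 := by
    have := γ.det_coe
    rw [Matrix.det_fin_two, ha, hb, hd, hc] at this
    linear_combination this
  have ha0 : a ≠ 0 := by
    rintro rfl
    have h1 : (q₁ : ℤ) ∣ 1 := ⟨-(b * q₂ * r), by linear_combination -hdet⟩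
    exact ne_one_of_dirichletCharacter_ne_one hχ₁ (Nat.dvd_one.1 (by exact_mod_cast h1))
  have hpi : (Real.pi : ℂ) * Complex.I ≠ 0 :=
    mul_ne_zero (by exact_mod_cast Real.pi_ne_zero) Complex.I_ne_zero
  have hL : gaussSum' q₁ (fun x => (starRingEnd ℂ) (χ₁ x)) *
      gaussSum' q₂ (fun x => (starRingEnd ℂ) (χ₂ x)) / ((Real.pi : ℂ) * Complex.I) ^ 2 *
      χ₁.LFunction 1 * χ₂.LFunction 1 = bernoulliOneConj χ₁ * bernoulliOneConj χ₂ := by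
    have h1 : _ = _ * bernoulliOneConj χ₁ := gaussSum'_mul_LFunction_one hp₁ ho₁
    have h2 : _ = _ * bernoulliOneConj χ₂ := gaussSum'_mul_LFunction_one hp₂ ho₂
    rw [div_mul_eq_mul_div, div_mul_eq_mul_div, div_eq_iff (pow_ne_zero 2 hpi)]
    linear_combination gaussSum' q₂ (fun x => (starRingEnd ℂ) (χ₂ x)) * χ₂.LFunction 1 * h1 -
      (Real.pi * Complex.I) * bernoulliOneConj χ₁ * h2
  have hψ : (starRingEnd ℂ) (χ₂ (d : ZMod q₂)) = χ₂ a := by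
    have h1 := congrArg (Int.cast (R := ZMod q₂)) hdet
    push_cast at h1
    rw [ZMod.natCast_self, mul_zero, zero_mul, sub_zero] at h1
    rw [starRingEnd_apply, MulChar.star_apply', ← one_mul (χ₂⁻¹ _), ← map_one χ₂, ← h1, map_mul,
      mul_assoc, ← MulChar.mul_apply, mul_inv_cancel, MulChar.one_apply (IsUnit.of_mul_eq_one_right _ h1),
      mul_one]
  have hS : newformDedekindSumSL χ₁ χ₂ γ = twistedDedekindSum χ₁ χ₂ a (r * q₁) := by
    have hpos : 0 < r * (q₁ * q₂) := by positivity
    have hc' : γ.1 1 0 = (q₂ * (r * q₁) : ℕ) := by rw [hc]; push_cast; ring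
    have hc1 : 1 ≤ γ.1 1 0 := by rw [hc]; exact_mod_cast hpos
    rw [newformDedekindSumSL, if_neg (by omega), if_pos hc1, ha, hc',
      newformDedekindSum_eq_twistedDedekindSum _ _ _ (by positivity)]
  have hS' : newformDedekindSumSL χ₂ χ₁ γ' =
      if b = 0 then 0 else twistedDedekindSum χ₂ χ₁ d (b.natAbs * q₂) := by
    rw [newformDedekindSumSL, h'a, h'c, hb, hd]
    have hq : 0 < (q₁ : ℤ) * q₂ := by positivity
    rcases lt_trichotomy b 0 with hb0 | rfl | hb0
    · have hc1 : 1 ≤ -b * ((q₁ : ℤ) * q₂) := by nlinarith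
      have hc' : -b * ((q₁ : ℤ) * q₂) = (q₁ * (b.natAbs * q₂) : ℕ) := by
        push_cast; rw [abs_of_neg hb0]; ring
      rw [if_neg (by omega), if_pos hc1, if_neg hb0.ne, hc',
        newformDedekindSum_eq_twistedDedekindSum _ _ _ (Nat.mul_pos (by omega) hq₂)]
    · simp
    · have hc1 : -b * ((q₁ : ℤ) * q₂) ≤ -1 := by nlinarith
      have hc' : -(-b * ((q₁ : ℤ) * q₂)) = (q₁ * (b.natAbs * q₂) : ℕ) := by
        push_cast; rw [abs_of_pos hb0]; ring
      have hβ : 0 < b.natAbs * q₂ := Nat.mul_pos (by omega) hq₂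
      rw [if_neg (by omega), if_neg (by omega), if_neg hb0.ne', hc',
        newformDedekindSum_eq_twistedDedekindSum _ _ _ hβ, twistedDedekindSum_neg _ ho₂ _ hβ]
  have hmain : twistedDedekindSum χ₁ χ₂ a (r * q₁) =
      (1 - χ₁ d * χ₂ a) * (bernoulliOneConj χ₁ * bernoulliOneConj χ₂) -
        if b = 0 then 0 else twistedDedekindSum χ₂ χ₁ d (b.natAbs * q₂) := by
    rcases Int.natAbs_eq a with haα | haα
    all_goals
      have hα : 0 < a.natAbs := Int.natAbs_pos.2 ha0
      generalize a.natAbs = α at haα hα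
      subst haα
    · simpa only [Int.cast_natCast] using
        twistedDedekindSum_eq_of_mul_sub_mul_eq_one hχ₁ hχ₂ ho₁ ho₂ hα hr' hdet
    · have h1 := twistedDedekindSum_eq_of_mul_sub_mul_eq_one hχ₁ hχ₂ ho₁ ho₂ hα hr' (b := b)
        (δ := -d) (by linear_combination hdet)
      have h2 : χ₁ ((-d : ℤ) : ZMod q₁) * χ₂ (α : ZMod q₂) =
          χ₁ d * χ₂ ((-α : ℤ) : ZMod q₂) := by
        push_cast
        rw [← neg_one_mul (d : ZMod q₁), ← neg_one_mul (α : ZMod q₂), map_mul, map_mul, ho₁, ho₂]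
        ring
      have h3 : (if b = 0 then 0 else twistedDedekindSum χ₂ χ₁ (-d) (b.natAbs * q₂)) =
          if b = 0 then 0 else twistedDedekindSum χ₂ χ₁ d (b.natAbs * q₂) := by
        split_ifs with hb0
        · rfl
        · exact twistedDedekindSum_neg _ ho₂ _ (Nat.mul_pos (Int.natAbs_pos.2 hb0) hq₂)
      rw [twistedDedekindSum_neg _ ho₁ _ (Nat.mul_pos hr' hq₁), h1, h2, h3]
  rw [hS, hS', hmain, hd, hψ]
  linear_combination -(1 - χ₁ d * χ₂ a) * hL
end

section
/- Let a and c be integers with gcd(a,c) = 1 and c = r·q₁·q₂ for some positive integer r. Then ∑_{j=0}^{c−1} ∑_{n=0}^{q₁−1} conj(χ₂)(j) · conj(χ₁)(n) · {aj/c + n/q₁} = 0, where {x} = x − ⌊x⌋ denotes the fractional part of x. -/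
open Complex Finset

theorem sum_range_neg_of_periodic {M : Type*} [AddCommGroup M] {f : ℤ → M} {N : ℕ}
    (hf : ∀ x, f (x + N) = f x) : ∑ j ∈ range N, f (-(j : ℤ)) = ∑ j ∈ range N, f j := by
  rw [← Finset.sum_range_reflect (fun j : ℕ => f (-(j : ℤ)))]
  have h : ∀ j ∈ range N, f (-((N - 1 - j : ℕ) : ℤ)) = f ((j + 1 : ℕ) : ℤ) := by
    intro j hj
    rw [Finset.mem_range] at hj
    rw [← hf (-((N - 1 - j : ℕ) : ℤ))]
    congr 1
    omega
  rw [Finset.sum_congr rfl h]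
  have h1 := Finset.sum_range_succ (fun j : ℕ => f j) N
  rw [Finset.sum_range_succ'] at h1
  have h2 : f (N : ℤ) = f ((0 : ℕ) : ℤ) := by simpa using hf 0
  rw [h2] at h1
  exact add_right_cancel h1

theorem DirichletCharacter.sum_range_eq_zero {q : ℕ} (hq : 0 < q)
    {χ : DirichletCharacter ℂ q} (hχ : χ ≠ 1) : ∑ n ∈ range q, χ (n : ZMod q) = 0 := by
  have : NeZero q := ⟨hq.ne'⟩
  rw [← MulChar.sum_eq_zero_of_ne_one hχ]
  refine Finset.sum_nbij' (fun n => (n : ZMod q)) (fun z => z.val) ?_ ?_ ?_ ?_ ?_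
  · simp
  · intro z _
    simpa using ZMod.val_lt z
  · intro n hn
    exact ZMod.val_cast_of_lt (by simpa using hn)
  · simp
  · simp

theorem DirichletCharacter.apply_intCast_eq_zero_of_dvd {q : ℕ} {χ : DirichletCharacter ℂ q}
    (hχ : χ ≠ 1) {j : ℤ} (hj : (q : ℤ) ∣ j) : χ (j : ZMod q) = 0 := by
  rw [(ZMod.intCast_zmod_eq_zero_iff_dvd j q).mpr hj]
  have : Nontrivial (ZMod q) := ZMod.nontrivial_iff.mpr fun h => by
    subst h
    exact hχ (DirichletCharacter.level_one χ)
  exact χ.map_zero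

theorem dvd_of_fract_div_add_div_eq_zero {q₁ q₂ : ℕ} (hq₁ : 0 < q₁) (hq₂ : 0 < q₂)
    {a r : ℤ} (hr : 0 < r) (hcop : IsCoprime a (r * ((q₁ : ℤ) * (q₂ : ℤ)))) {j n : ℤ}
    (h : Int.fract ((a : ℝ) * (j : ℝ) / ((r * ((q₁ : ℤ) * (q₂ : ℤ)) : ℤ) : ℝ) +
      (n : ℝ) / (q₁ : ℝ)) = 0) : (q₂ : ℤ) ∣ j := by
  obtain ⟨z, hz⟩ := Int.fract_eq_zero_iff.mp h
  have h1 : (q₁ : ℝ) ≠ 0 := by positivity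
  have h2 : (q₂ : ℝ) ≠ 0 := by positivity
  have h3 : (r : ℝ) ≠ 0 := by positivity
  push_cast at hz
  field_simp at hz
  have hcop' : IsCoprime (q₂ : ℤ) a :=
    (hcop.of_isCoprime_of_dvd_right ⟨r * q₁, by ring⟩).symm
  refine hcop'.dvd_of_dvd_mul_left ⟨r * (z * q₁ - n), ?_⟩
  have h4 : (a : ℝ) * j = q₂ * (r * (z * q₁ - n)) := by linarith
  exact_mod_cast h4

theorem character_sum_fract_eq_zero {q₁ q₂ : ℕ} (hq₁ : 0 < q₁) (hq₂ : 0 < q₂)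
    (χ₁ : DirichletCharacter ℂ q₁) (χ₂ : DirichletCharacter ℂ q₂)
    (hχ₁ : χ₁ ≠ 1) (hχ₂ : χ₂ ≠ 1) (hp₁ : χ₁.IsPrimitive) (hp₂ : χ₂.IsPrimitive)
    (hpar : χ₁ (-1) * χ₂ (-1) = 1)
    (a c r : ℤ) (hr : 0 < r) (hc : c = r * ((q₁ : ℤ) * (q₂ : ℤ))) (hcop : IsCoprime a c) :
    ∑ j ∈ Finset.range c.toNat, ∑ n ∈ Finset.range q₁,
      (starRingEnd ℂ) (χ₂ (j : ZMod q₂)) * (starRingEnd ℂ) (χ₁ (n : ZMod q₁)) *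
        (Complex.ofReal (Int.fract ((a : ℝ) * (j : ℝ) / (c : ℝ) + (n : ℝ) / (q₁ : ℝ)))) = 0 := by
  have hcpos : 0 < c := by rw [hc]; positivity
  have hc0 : (c : ℝ) ≠ 0 := by exact_mod_cast hcpos.ne'
  have hq0 : (q₁ : ℝ) ≠ 0 := by positivity
  let w : ℤ → ℤ → ℂ := fun j n =>
    (starRingEnd ℂ) (χ₂ (j : ZMod q₂)) * (starRingEnd ℂ) (χ₁ (n : ZMod q₁))
  let x : ℤ → ℤ → ℝ := fun j n => (a : ℝ) * (j : ℝ) / (c : ℝ) + (n : ℝ) / (q₁ : ℝ)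
  let F : ℤ → ℤ → ℂ := fun j n => w j n * (Int.fract (x j n) : ℝ)
  have hFj : ∀ n j, F (j + c.toNat) n = F j n := by
    intro n j
    have hcast : ((c : ℤ) : ZMod q₂) = 0 :=
      (ZMod.intCast_zmod_eq_zero_iff_dvd c q₂).mpr ⟨r * q₁, by rw [hc]; ring⟩
    have hx : x (j + c) n = x j n + (a : ℤ) := by
      simp only [x]
      push_cast
      field_simp
      ring
    rw [Int.toNat_of_nonneg hcpos.le]
    simp only [F, hx, Int.fract_add_intCast, w, Int.cast_add, hcast, add_zero]
  have hFn : ∀ j n, F j (n + q₁) = F j n := by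
    intro j n
    have hx : x j (n + q₁) = x j n + (1 : ℤ) := by
      simp only [x]
      push_cast
      field_simp
      ring
    simp only [F, hx, Int.fract_add_intCast, w, Int.cast_add, Int.cast_natCast,
      CharP.cast_eq_zero, add_zero]
  have hw : ∀ j n, w (-j) (-n) = w j n := by
    intro j n
    have h1 : χ₁ ((-n : ℤ) : ZMod q₁) = χ₁ (-1) * χ₁ n := by
      rw [← map_mul]; simp
    have h2 : χ₂ ((-j : ℤ) : ZMod q₂) = χ₂ (-1) * χ₂ j := by
      rw [← map_mul]; simp
    simp only [w, ← map_mul (starRingEnd ℂ), h1, h2]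
    congr 1
    linear_combination (χ₁ n * χ₂ j) * hpar
  have hneg : ∀ j n, F (-j) (-n) = w j n - F j n := by
    intro j n
    simp only [F, hw]
    have hx : x (-j) (-n) = -x j n := by
      simp only [x]
      push_cast
      ring
    by_cases h : Int.fract (x j n) = 0
    · have hd : (q₂ : ℤ) ∣ j := by
        subst hc
        exact dvd_of_fract_div_add_div_eq_zero hq₁ hq₂ hr hcop h
      have h0 : w j n = 0 := by
        simp [w, DirichletCharacter.apply_intCast_eq_zero_of_dvd hχ₂ hd]
      simp [h0]
    · rw [hx, Int.fract_neg h]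
      push_cast
      ring
  have hwsum : ∑ j ∈ range c.toNat, ∑ n ∈ range q₁, w j n = 0 := by
    refine Finset.sum_eq_zero fun j _ => ?_
    simp only [w, Int.cast_natCast]
    rw [← Finset.mul_sum, ← map_sum, DirichletCharacter.sum_range_eq_zero hq₁ hχ₁]
    simp
  have hS : ∑ j ∈ range c.toNat, ∑ n ∈ range q₁, F (-(j : ℤ)) (-(n : ℤ)) =
      ∑ j ∈ range c.toNat, ∑ n ∈ range q₁, F j n := by
    simp only [sum_range_neg_of_periodic (hFn _)]
    exact sum_range_neg_of_periodic (f := fun j => ∑ n ∈ range q₁, F j n)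
      fun j => Finset.sum_congr rfl fun n _ => hFj n j
  simp only [hneg, Finset.sum_sub_distrib, hwsum, zero_sub] at hS
  have h0 : ∑ j ∈ range c.toNat, ∑ n ∈ range q₁, F j n = 0 := self_eq_neg.mp hS.symm
  simpa only [F, w, x, Int.cast_natCast] using h0
end

section
/- Let a and c be integers with gcd(a,c) = 1 and c = r·q₁·q₂ for some positive integer r. Then ∑_{j=0}^{c−1} ∑_{n=0}^{q₁−1} conj(χ₂)(j) · conj(χ₁)(n) · (a·j²/c² + n·j/(c·q₁)) = (1/(q₁q₂)) · (∑_{m=0}^{q₂−1} conj(χ₂)(m)·m) · (∑_{n=0}^{q₁−1} conj(χ₁)(n)·n). -/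
open Complex Finset

/-- The first moment of a mean-zero function on `ZMod q` over `N` periods is `N` times its first
moment over one period. -/
theorem ZMod.sum_range_mul_self_of_sum_eq_zero {q : ℕ} {f : ZMod q → ℂ}
    (hf : ∑ n ∈ range q, f n = 0) (N : ℕ) :
    ∑ j ∈ range (N * q), f j * j = N * ∑ m ∈ range q, f m * m := by
  induction N with
  | zero => simp
  | succ N ih =>
    have h : ∑ m ∈ range q, f ((N * q + m : ℕ) : ZMod q) * ((N * q + m : ℕ) : ℂ) =
        (∑ m ∈ range q, f m) * (N * q) + ∑ m ∈ range q, f m * m := by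
      rw [sum_mul, ← sum_add_distrib]
      refine sum_congr rfl fun m _ ↦ ?_
      simp [mul_add]
    rw [Nat.succ_mul, sum_range_add, ih, h, hf]
    push_cast
    ring

theorem character_sum_P_formula {q₁ q₂ : ℕ} (hq₁ : 0 < q₁) (hq₂ : 0 < q₂)
    (χ₁ : DirichletCharacter ℂ q₁) (χ₂ : DirichletCharacter ℂ q₂)
    (hχ₁ : χ₁ ≠ 1) (hχ₂ : χ₂ ≠ 1) (hp₁ : χ₁.IsPrimitive) (hp₂ : χ₂.IsPrimitive)
    (hpar : χ₁ (-1) * χ₂ (-1) = 1)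
    (a c r : ℤ) (hr : 0 < r) (hc : c = r * ((q₁ : ℤ) * (q₂ : ℤ))) (hcop : IsCoprime a c) :
    ∑ j ∈ Finset.range c.toNat, ∑ n ∈ Finset.range q₁,
      (starRingEnd ℂ) (χ₂ (j : ZMod q₂)) * (starRingEnd ℂ) (χ₁ (n : ZMod q₁)) *
        ((a : ℂ) * (j : ℂ) ^ 2 / (c : ℂ) ^ 2 + (n : ℂ) * (j : ℂ) / ((c : ℂ) * (q₁ : ℂ))) =
      (1 / ((q₁ : ℂ) * (q₂ : ℂ))) *
        (∑ m ∈ Finset.range q₂, (starRingEnd ℂ) (χ₂ (m : ZMod q₂)) * (m : ℂ)) *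
        (∑ n ∈ Finset.range q₁, (starRingEnd ℂ) (χ₁ (n : ZMod q₁)) * (n : ℂ)) := by
  have h₁ : ∑ n ∈ range q₁, (starRingEnd ℂ) (χ₁ (n : ZMod q₁)) = 0 := by
    rw [← map_sum, DirichletCharacter.sum_range_eq_zero hq₁ hχ₁, map_zero]
  have h₂ : ∑ n ∈ range q₂, (starRingEnd ℂ) (χ₂ (n : ZMod q₂)) = 0 := by
    rw [← map_sum, DirichletCharacter.sum_range_eq_zero hq₂ hχ₂, map_zero]
  lift r to ℕ using hr.le
  have hcN : c.toNat = r * q₁ * q₂ := by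
    rw [hc, ← mul_assoc]
    norm_cast
  have hcC : (c : ℂ) = r * q₁ * q₂ := by
    rw [hc]
    push_cast
    ring
  have hr0 : (r : ℂ) ≠ 0 := by
    have : r ≠ 0 := by omega
    exact_mod_cast this
  have hq₁0 : (q₁ : ℂ) ≠ 0 := by exact_mod_cast hq₁.ne'
  have hq₂0 : (q₂ : ℂ) ≠ 0 := by exact_mod_cast hq₂.ne'
  have hmoment := ZMod.sum_range_mul_self_of_sum_eq_zero
    (f := fun x ↦ (starRingEnd ℂ) (χ₂ x)) h₂ (r * q₁)
  have hinner (j : ℕ) : ∑ n ∈ range q₁,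
      (starRingEnd ℂ) (χ₂ (j : ZMod q₂)) * (starRingEnd ℂ) (χ₁ (n : ZMod q₁)) *
        ((a : ℂ) * (j : ℂ) ^ 2 / (c : ℂ) ^ 2 + (n : ℂ) * (j : ℂ) / ((c : ℂ) * (q₁ : ℂ))) =
      (starRingEnd ℂ) (χ₂ (j : ZMod q₂)) * j *
        ((∑ n ∈ range q₁, (starRingEnd ℂ) (χ₁ (n : ZMod q₁)) * (n : ℂ)) / (c * q₁)) := by
    calc _ = (starRingEnd ℂ) (χ₂ (j : ZMod q₂)) * ((a : ℂ) * (j : ℂ) ^ 2 / (c : ℂ) ^ 2) *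
          (∑ n ∈ range q₁, (starRingEnd ℂ) (χ₁ (n : ZMod q₁))) +
        (starRingEnd ℂ) (χ₂ (j : ZMod q₂)) * j / (c * q₁) *
          ∑ n ∈ range q₁, (starRingEnd ℂ) (χ₁ (n : ZMod q₁)) * (n : ℂ) := by
          rw [mul_sum, mul_sum, ← sum_add_distrib]
          exact sum_congr rfl fun n _ ↦ by ring
      _ = _ := by rw [h₁]; ring
  simp_rw [hinner]
  rw [← sum_mul, hcN, hmoment, hcC]
  push_cast
  field_simp
end
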